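/- Let X be an infinite compact Hausdorff space, let α : X → X be a minimal homeomorphism, and let N be a natural number. Then there is a nonempty open set U ⊆ X such that U ∩ α^n(U) = ∅ for every integer n with 0 < |n| ≤ N. -/

import Mathlib

lemma aux_cont {X : Type*} [TopologicalSpace X] (α : X ≃ₜ X) (n : ℤ) :
    Continuous (α.toEquiv ^ n : Equiv.Perm X) := by
  have hnat : ∀ (β : X ≃ₜ X) (k : ℕ), Continuous ((β.toEquiv : Equiv.Perm X) ^ k : Equiv.Perm X) := by
    intro β k
    induction k with
    | zero => simpa using continuous_id
    | succ k ih =>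
      rw [pow_succ, Equiv.Perm.coe_mul]
      exact ih.comp β.continuous
  obtain ⟨k, rfl | rfl⟩ := n.eq_nat_or_neg
  · rw [zpow_natCast]; exact hnat α k
  · rw [zpow_neg, zpow_natCast, ← inv_pow]; exact hnat α.symm k

lemma aux_free {X : Type*} [TopologicalSpace X] [T2Space X] [Infinite X]
    (α : X ≃ₜ X)
    (hmin : ∀ C : Set X, IsClosed C → (⇑α) '' C = C → C = ∅ ∨ C = Set.univ)
    (x : X) (n : ℤ) (hn : n ≠ 0) : (α.toEquiv ^ n : Equiv.Perm X) x ≠ x := by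
  intro h
  let p : Equiv.Perm X := α.toEquiv
  have hp : (p ^ n) x = x := h
  have hfin : (Set.range (fun m : ℤ => (p ^ m) x)).Finite := by
    apply ((Set.finite_Ico (0 : ℤ) |n|).image (fun m : ℤ => (p ^ m) x)).subset
    rintro _ ⟨m, rfl⟩
    refine ⟨m % n, ⟨Int.emod_nonneg _ hn, Int.emod_lt_abs _ hn⟩, ?_⟩
    have : p ^ m = p ^ (m % n) * (p ^ n) ^ (m / n) := by
      rw [← zpow_mul, ← zpow_add, Int.emod_add_mul_ediv]
    simp only [this, Equiv.Perm.mul_apply,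
      Equiv.Perm.zpow_apply_eq_self_of_apply_eq_self hp]
  rcases hmin _ hfin.isClosed (by
    ext y
    constructor
    · rintro ⟨_, ⟨m, rfl⟩, rfl⟩
      refine ⟨1 + m, ?_⟩
      simp only [zpow_add, zpow_one, Equiv.Perm.mul_apply]
      rfl
    · rintro ⟨m, rfl⟩
      refine ⟨_, ⟨m - 1, rfl⟩, ?_⟩
      change p ((p ^ (m - 1)) x) = (p ^ m) x
      rw [← Equiv.Perm.mul_apply, ← zpow_one_add]
      congr 2
      ring) with h0 | h1
  · exact (Set.range_nonempty _).ne_empty h0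
  · rw [h1] at hfin
    exact Set.infinite_univ hfin

/-- For a minimal homeomorphism `α` of an infinite compact Hausdorff space and
any `N : ℕ`, there is a nonempty open set `U` with `U ∩ α^n(U) = ∅` for all integers `n`
with `0 < |n| ≤ N`. -/
theorem stmt5 {X : Type*} [TopologicalSpace X] [CompactSpace X] [T2Space X] [Infinite X]
    (α : X ≃ₜ X)
    (hmin : ∀ C : Set X, IsClosed C → (⇑α) '' C = C → C = ∅ ∨ C = Set.univ)
    (N : ℕ) :
    ∃ U : Set X, U.Nonempty ∧ IsOpen U ∧
      ∀ n : ℤ, 0 < |n| → |n| ≤ (N : ℤ) → U ∩ ((α.toEquiv ^ n) '' U) = ∅ := by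
  obtain ⟨x⟩ : Nonempty X := inferInstance
  have key : ∀ n : ℤ, ∃ V : Set X, IsOpen V ∧ x ∈ V ∧
      (n ≠ 0 → V ∩ ((α.toEquiv ^ n : Equiv.Perm X) '' V) = ∅) := by
    intro n
    by_cases hn : n = 0
    · exact ⟨Set.univ, isOpen_univ, trivial, fun h => absurd hn h⟩
    · obtain ⟨A, B, hA, hB, hxB, hxA, hd⟩ := t2_separation (aux_free α hmin x n hn)
      refine ⟨B ∩ (α.toEquiv ^ n : Equiv.Perm X) ⁻¹' A,
        hB.inter (hA.preimage (aux_cont α n)), ⟨hxA, hxB⟩, fun _ => ?_⟩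
      ext y
      simp only [Set.mem_empty_iff_false, iff_false]
      rintro ⟨⟨hy, -⟩, z, ⟨-, hz⟩, rfl⟩
      exact Set.disjoint_left.1 hd hz hy
  choose V hVo hxV hV using key
  refine ⟨⋂ n ∈ Set.Icc (-(N : ℤ)) N, V n, ⟨x, ?_⟩, ?_, ?_⟩
  · simp only [Set.mem_iInter]
    exact fun n _ => hxV n
  · exact (Set.finite_Icc _ _).isOpen_biInter fun n _ => hVo n
  · intro n h0 hN
    have hsub : (⋂ n ∈ Set.Icc (-(N : ℤ)) N, V n) ⊆ V n :=
      Set.biInter_subset_of_mem (abs_le.1 hN)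
    exact Set.subset_eq_empty (Set.inter_subset_inter hsub (Set.image_mono hsub))
      (hV n (abs_pos.1 h0))
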